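/- arXiv:0905.0270 — 2 statements merged into one kernel-verified Lean document; each statement's English description precedes it below -/
import Mathlib

section
/- Let d ≥ 3 and 0 < q < d/2, and let V : ℤ^d → [0,∞) satisfy sup_{s>0} s^q ν(s,V) < ∞. Then, with the constants c₀, c₁ > 0 depending only on d and q, c₀ · limsup_{s→0⁺} ( s^q ν(s,V) ) ≤ limsup_{s→0⁺} ( s^q n(s,V) ) ≤ c₁ · limsup_{s→0⁺} ( s^q ν(s,V) ). In particular, s^q n(s,V) → 0 as s → 0⁺ (equivalently, N₋(H_{αV}) = o(α^q) as α → ∞) if and only if s^q ν(s,V) → 0 as s → 0⁺. -/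
open scoped ENNReal NNReal Topology
open Filter MeasureTheory

noncomputable section

/-- The lattice point `1_j` in `ℤ^d`: `j`-th coordinate `1`, all others `0`. -/
def latUnit (d : ℕ) (j : Fin d) : Fin d → ℤ := fun i => if i = j then 1 else 0

/-- The discrete Dirichlet form `Q_0[u] = Σ_x Σ_j |u(x+1_j) − u(x)|²`, valued in `[0,∞]`. -/
def Q0 {d : ℕ} (u : (Fin d → ℤ) → ℂ) : ℝ≥0∞ :=
  ∑' x : Fin d → ℤ, ∑ j : Fin d, ((‖u (x + latUnit d j) - u x‖₊ : ℝ≥0∞)) ^ 2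

/-- `b_V[u] = Σ_x V(x)|u(x)|²`, valued in `[0,∞]`. -/
def bV {d : ℕ} (V : (Fin d → ℤ) → ℝ) (u : (Fin d → ℤ) → ℂ) : ℝ≥0∞ :=
  ∑' x : Fin d → ℤ, ENNReal.ofReal (V x) * ((‖u x‖₊ : ℝ≥0∞)) ^ 2

/-- The Euclidean norm `|x|` of a lattice point. -/
def znorm {d : ℕ} (x : Fin d → ℤ) : ℝ := Real.sqrt (∑ i, ((x i : ℝ)) ^ 2)

/-- The counting function `n(s,V)`: the supremum, in `ℕ∞`, of `dim L` over all
finite-dimensional subspaces `L` of the space of finitely supported functions with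
`b_V[u] > s·Q_0[u]` for all nonzero `u ∈ L` (the `s`-admissible subspaces). -/
def nCount (d : ℕ) (V : (Fin d → ℤ) → ℝ) (s : ℝ) : ℕ∞ :=
  ⨆ L : {L : Submodule ℂ ((Fin d → ℤ) → ℂ) //
      (∀ u ∈ L, (Function.support u).Finite) ∧ FiniteDimensional ℂ L ∧
      ∀ u ∈ L, u ≠ 0 → ENNReal.ofReal s * Q0 u < bV V u},
    (Module.finrank ℂ L.1 : ℕ∞)

/-- `ν(s,V)`: the number (in `ℕ∞`) of lattice points with `V(x) > s`. -/
def nuCount (d : ℕ) (V : (Fin d → ℤ) → ℝ) (s : ℝ) : ℕ∞ :=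
  {x : Fin d → ℤ | s < V x}.encard

section Torus

open UnitAddTorus ComplexConjugate

attribute [local instance] instMeasureSpaceUnitAddCircle

local instance isProbabilityMeasure_unitAddCircle :
    IsProbabilityMeasure (volume : Measure UnitAddCircle) :=
  inferInstanceAs (IsProbabilityMeasure AddCircle.haarAddCircle)

variable {d : ℕ}

/-- The symbol `∑ⱼ |e^{2πiθⱼ} - 1|²` of the discrete Laplacian. -/
def laplaceSymbol (θ : UnitAddTorus (Fin d)) : ℝ :=
  ∑ j, ‖mFourier (latUnit d j) θ - 1‖ ^ 2

lemma continuous_laplaceSymbol : Continuous (laplaceSymbol (d := d)) := by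
  unfold laplaceSymbol
  fun_prop

lemma laplaceSymbol_nonneg (θ : UnitAddTorus (Fin d)) : 0 ≤ laplaceSymbol θ :=
  Finset.sum_nonneg fun _ _ => by positivity

/-- The trigonometric polynomial with prescribed Fourier coefficients. -/
def trigPoly : ((Fin d → ℤ) →₀ ℂ) →ₗ[ℂ] C(UnitAddTorus (Fin d), ℂ) :=
  Finsupp.linearCombination ℂ mFourier

lemma mFourierCoeff_trigPoly (u : (Fin d → ℤ) →₀ ℂ) (x : Fin d → ℤ) :
    mFourierCoeff (trigPoly u) x = u x := by
  rw [← mFourierCoeff_toLp, ← mFourierBasis_repr, HilbertBasis.repr_apply_apply]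
  have h : ContinuousMap.toLp 2 volume ℂ (trigPoly u) =
      Finsupp.linearCombination ℂ (mFourierLp 2) u := by
    rw [trigPoly, ← ContinuousLinearMap.coe_coe, Finsupp.apply_linearCombination]
    rfl
  rw [h, coe_mFourierBasis, orthonormal_mFourier.inner_right_finsupp]

lemma L2_enorm_sq {α : Type*} [MeasurableSpace α] {μ : Measure α} {f : α → ℂ}
    (hf : MemLp f 2 μ) : ‖hf.toLp f‖ₑ ^ 2 = ∫⁻ t, ‖f t‖ₑ ^ 2 ∂μ := by
  rw [Lp.enorm_toLp, eLpNorm_eq_lintegral_rpow_enorm_toReal (by simp) (by simp),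
    ← ENNReal.rpow_natCast, ← ENNReal.rpow_mul]
  simp

lemma tsum_enorm_mFourierCoeff_sq {f : UnitAddTorus (Fin d) → ℂ} (hf : MemLp f 2 volume) :
    ∑' x, ‖mFourierCoeff f x‖ₑ ^ 2 = ∫⁻ t, ‖f t‖ₑ ^ 2 := by
  have hcoeff : ∀ x, mFourierCoeff f x = mFourierCoeff (hf.toLp f) x := fun x =>
    integral_congr_ae (by filter_upwards [hf.coeFn_toLp] with t ht; rw [ht])
  have key := hasSum_sq_mFourierCoeff (hf.toLp f)
  have hnorm : ∫ t, ‖hf.toLp f t‖ ^ 2 = ‖hf.toLp f‖ ^ 2 := by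
    have := L2.inner_def (𝕜 := ℂ) (hf.toLp f) (hf.toLp f)
    rw [inner_self_eq_norm_sq_to_K] at this
    simp only [inner_self_eq_norm_sq_to_K] at this
    exact_mod_cast this.symm
  rw [hnorm] at key
  simp_rw [hcoeff]
  rw [← L2_enorm_sq hf, ← ofReal_norm, ← ENNReal.ofReal_pow (norm_nonneg _), ← key.tsum_eq,
    ENNReal.ofReal_tsum_of_nonneg (fun _ => by positivity) key.summable]
  simp only [← ofReal_norm, ENNReal.ofReal_pow (norm_nonneg _)]

lemma memLp_of_continuous {f : UnitAddTorus (Fin d) → ℂ} (hf : Continuous f) :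
    MemLp f 2 volume := by
  obtain ⟨C, hC⟩ := isCompact_univ.exists_bound_of_continuousOn hf.continuousOn
  exact MemLp.of_bound hf.aestronglyMeasurable C (ae_of_all _ fun x => hC x (Set.mem_univ _))

lemma integrable_of_continuous {f : UnitAddTorus (Fin d) → ℂ} (hf : Continuous f) :
    Integrable f volume :=
  (memLp_of_continuous hf).integrable (by norm_num)

lemma Q0_eq_lintegral (u : (Fin d → ℤ) →₀ ℂ) :
    Q0 u = ∫⁻ θ, ENNReal.ofReal (laplaceSymbol θ) * ‖trigPoly u θ‖ₑ ^ 2 := by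
  have hD : ∀ j x, u (x + latUnit d j) - u x =
      mFourierCoeff (fun θ => (mFourier (-latUnit d j) θ - 1) * trigPoly u θ) x := by
    intro j x
    rw [← mFourierCoeff_trigPoly, ← mFourierCoeff_trigPoly u x]
    unfold mFourierCoeff
    rw [← integral_sub (integrable_of_continuous (by fun_prop))
      (integrable_of_continuous (by fun_prop))]
    congr 1 with θ
    rw [neg_add, mFourier_add]
    simp only [smul_eq_mul]
    ring
  unfold Q0
  rw [Summable.tsum_finsetSum (fun _ _ => ENNReal.summable)]
  have : ∀ j, ∑' x, (‖u (x + latUnit d j) - u x‖₊ : ℝ≥0∞) ^ 2 =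
      ∫⁻ θ, ENNReal.ofReal (‖mFourier (latUnit d j) θ - 1‖ ^ 2) * ‖trigPoly u θ‖ₑ ^ 2 := by
    intro j
    simp_rw [hD]
    refine (tsum_enorm_mFourierCoeff_sq (memLp_of_continuous (by fun_prop))).trans ?_
    congr 1 with θ
    rw [enorm_mul, mul_pow, mFourier_neg, ENNReal.ofReal_pow (norm_nonneg _), ofReal_norm]
    congr 2
    simpa using RCLike.enorm_conj (mFourier (latUnit d j) θ - 1)
  simp_rw [this]
  rw [← lintegral_finsetSum]
  · congr 1 with θ
    rw [laplaceSymbol, ENNReal.ofReal_sum_of_nonneg (fun _ _ => by positivity), Finset.sum_mul]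
  · intro j _
    fun_prop

/-- The map `u ↦ √(laplaceSymbol) · û`, an isometry from the Dirichlet form to `L²`. -/
def energyMap : ((Fin d → ℤ) →₀ ℂ) →ₗ[ℂ] Lp ℂ 2 (volume : Measure (UnitAddTorus (Fin d))) :=
  (ContinuousMap.toLp 2 volume ℂ).toLinearMap ∘ₗ
    LinearMap.mulLeft ℂ (⟨fun θ => (√(laplaceSymbol θ) : ℂ),
      Complex.continuous_ofReal.comp continuous_laplaceSymbol.sqrt⟩ : C(UnitAddTorus (Fin d), ℂ))
    ∘ₗ trigPoly

lemma coeFn_energyMap (u : (Fin d → ℤ) →₀ ℂ) :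
    energyMap u =ᵐ[volume] fun θ => (√(laplaceSymbol θ) : ℂ) * trigPoly u θ :=
  ContinuousMap.coeFn_toLp volume _

lemma enorm_energyMap_sq (u : (Fin d → ℤ) →₀ ℂ) : ‖energyMap u‖ₑ ^ 2 = Q0 u := by
  have hm := Lp.memLp (energyMap u)
  rw [Q0_eq_lintegral, ← Lp.toLp_coeFn (energyMap u) hm, L2_enorm_sq]
  refine lintegral_congr_ae ?_
  filter_upwards [coeFn_energyMap u] with θ hθ
  rw [hθ, enorm_mul, mul_pow, ← ofReal_norm, Complex.norm_real, Real.norm_of_nonneg (Real.sqrt_nonneg _),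
    ← ENNReal.ofReal_pow (Real.sqrt_nonneg _), Real.sq_sqrt (laplaceSymbol_nonneg _)]

lemma sum_enorm_mFourierCoeff_indicator_sq_le {ι : Type*} [Fintype ι]
    {u : ι → (Fin d → ℤ) →₀ ℂ} (hu : Orthonormal ℂ fun i => energyMap (u i))
    {A : Set (UnitAddTorus (Fin d))} (hA : MeasurableSet A) (x : Fin d → ℤ) :
    ∑ i, ‖mFourierCoeff (A.indicator (trigPoly (u i))) x‖ₑ ^ 2 ≤
      ∫⁻ θ in A, (ENNReal.ofReal (laplaceSymbol θ))⁻¹ := by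
  by_cases hfin : ∫⁻ θ in A, (ENNReal.ofReal (laplaceSymbol θ))⁻¹ = ⊤
  · exact hfin ▸ le_top
  have hmeas : Measurable fun θ : UnitAddTorus (Fin d) =>
      (ENNReal.ofReal (laplaceSymbol θ))⁻¹ :=
    (continuous_laplaceSymbol.measurable.ennreal_ofReal).inv
  have hpos : ∀ᵐ θ, θ ∈ A → 0 < laplaceSymbol θ := by
    rw [← ae_restrict_iff' hA]
    filter_upwards [ae_lt_top hmeas hfin] with θ hθ
    simpa using hθ
  set h : UnitAddTorus (Fin d) → ℂ :=
    A.indicator fun θ => mFourier x θ * ((√(laplaceSymbol θ))⁻¹ : ℝ) with hh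
  have hsq : ∀ θ, ‖h θ‖ₑ ^ 2 ≤ A.indicator (fun θ => (ENNReal.ofReal (laplaceSymbol θ))⁻¹) θ := by
    intro θ
    by_cases hθ : θ ∈ A
    · rw [hh, Set.indicator_of_mem hθ, Set.indicator_of_mem hθ, enorm_mul, mul_pow]
      have h1 : ‖mFourier x θ‖ₑ ≤ 1 := by
        rw [← ofReal_norm, ← ENNReal.ofReal_one]
        exact ENNReal.ofReal_le_ofReal (((mFourier x).norm_coe_le_norm θ).trans mFourier_norm.le)
      have h2 : ‖(((√(laplaceSymbol θ))⁻¹ : ℝ) : ℂ)‖ₑ ^ 2 ≤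
          (ENNReal.ofReal (laplaceSymbol θ))⁻¹ := by
        rcases (laplaceSymbol_nonneg θ).eq_or_lt with h0 | h0
        · simp [← h0]
        · rw [← ENNReal.ofReal_inv_of_pos h0, ← ofReal_norm, Complex.norm_real,
            Real.norm_of_nonneg (by positivity), ← ENNReal.ofReal_pow (by positivity), inv_pow,
            Real.sq_sqrt h0.le]
      calc _ ≤ 1 ^ 2 * (ENNReal.ofReal (laplaceSymbol θ))⁻¹ := by gcongr
        _ = _ := by rw [one_pow, one_mul]
    · simp [hh, hθ]
  have hle : ∫⁻ θ, ‖h θ‖ₑ ^ 2 ≤ ∫⁻ θ in A, (ENNReal.ofReal (laplaceSymbol θ))⁻¹ := by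
    rw [← lintegral_indicator hA]
    exact lintegral_mono hsq
  have hmem : MemLp h 2 volume := by
    refine ⟨?_, ?_⟩
    · refine (Measurable.indicator ?_ hA).aestronglyMeasurable
      refine (mFourier x).continuous.measurable.mul ?_
      exact Complex.measurable_ofReal.comp continuous_laplaceSymbol.sqrt.measurable.inv
    · rw [eLpNorm_lt_top_iff_lintegral_rpow_enorm_lt_top (by simp) (by simp)]
      simpa using hle.trans_lt (lt_top_iff_ne_top.2 hfin)
  have hinner : ∀ i, mFourierCoeff (A.indicator (trigPoly (u i))) x =
      inner ℂ (hmem.toLp h) (energyMap (u i)) := by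
    intro i
    rw [L2.inner_def]
    refine integral_congr_ae ?_
    filter_upwards [hmem.coeFn_toLp, coeFn_energyMap (u i), hpos] with θ h1 h2 h3
    rw [h1, h2, RCLike.inner_apply, hh, mFourier_neg]
    by_cases hθ : θ ∈ A
    · have : (√(laplaceSymbol θ) : ℂ) ≠ 0 := by
        exact_mod_cast (Real.sqrt_pos.2 (h3 hθ)).ne'
      simp only [Set.indicator_of_mem hθ, map_mul, map_inv₀, Complex.conj_ofReal,
        smul_eq_mul, Complex.ofReal_inv]
      field_simp
    · simp [hθ]
  refine le_trans ?_ hle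
  rw [← L2_enorm_sq hmem]
  have hbessel := hu.sum_inner_products_le (hmem.toLp h) (s := Finset.univ)
  simp_rw [hinner, ← ofReal_norm, ← ENNReal.ofReal_pow (norm_nonneg _)]
  rw [← ENNReal.ofReal_sum_of_nonneg (fun _ _ => by positivity)]
  refine ENNReal.ofReal_le_ofReal (le_trans (Finset.sum_le_sum fun i _ => ?_) hbessel)
  rw [norm_inner_symm]

lemma tsum_enorm_mFourierCoeff_indicator_sq (u : (Fin d → ℤ) →₀ ℂ)
    {A : Set (UnitAddTorus (Fin d))} (hA : MeasurableSet A) :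
    ∑' x, ‖mFourierCoeff (A.indicator (trigPoly u)) x‖ₑ ^ 2 = ∫⁻ θ in A, ‖trigPoly u θ‖ₑ ^ 2 := by
  rw [tsum_enorm_mFourierCoeff_sq ((memLp_of_continuous (trigPoly u).continuous).indicator hA),
    ← lintegral_indicator hA]
  congr 1 with θ
  by_cases hθ : θ ∈ A <;> simp [hθ]

lemma enorm_sq_le_mFourierCoeff_indicator (u : (Fin d → ℤ) →₀ ℂ)
    {A : Set (UnitAddTorus (Fin d))} (hA : MeasurableSet A) (x : Fin d → ℤ) :
    ‖u x‖ₑ ^ 2 ≤ 2 * ‖mFourierCoeff (A.indicator (trigPoly u)) x‖ₑ ^ 2 +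
      2 * ‖mFourierCoeff (Aᶜ.indicator (trigPoly u)) x‖ₑ ^ 2 := by
  have hi : ∀ B : Set (UnitAddTorus (Fin d)), MeasurableSet B →
      Integrable (fun θ => mFourier (-x) θ • B.indicator (trigPoly u) θ) volume := by
    intro B hB
    have := (integrable_of_continuous (f := fun θ => mFourier (-x) θ * trigPoly u θ)
      (by fun_prop)).indicator hB
    refine this.congr (ae_of_all _ fun θ => ?_)
    by_cases hθ : θ ∈ B <;> simp [hθ]
  have hsplit : u x = mFourierCoeff (A.indicator (trigPoly u)) x +
      mFourierCoeff (Aᶜ.indicator (trigPoly u)) x := by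
    rw [← mFourierCoeff_trigPoly u x]
    unfold mFourierCoeff
    rw [← integral_add (hi A hA) (hi Aᶜ hA.compl)]
    congr 1 with θ
    by_cases hθ : θ ∈ A <;> simp [hθ]
  rw [hsplit]
  set a := mFourierCoeff (A.indicator (trigPoly u)) x
  set b := mFourierCoeff (Aᶜ.indicator (trigPoly u)) x
  simp_rw [← ofReal_norm, ← ENNReal.ofReal_pow (norm_nonneg _)]
  rw [← ENNReal.ofReal_ofNat 2, ← ENNReal.ofReal_mul (by simp), ← ENNReal.ofReal_mul (by simp),
    ← ENNReal.ofReal_add (by positivity) (by positivity)]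
  refine ENNReal.ofReal_le_ofReal ?_
  nlinarith [norm_add_le a b, norm_nonneg (a + b), norm_nonneg a, norm_nonneg b,
    sq_nonneg (‖a‖ - ‖b‖)]

lemma four_mul_norm_le (t : UnitAddCircle) : 4 * ‖t‖ ≤ ‖(fourier 1 t : ℂ) - 1‖ := by
  induction t using QuotientAddGroup.induction_on with
  | H x =>
    have hround : ((x - round x : ℝ) : UnitAddCircle) = (x : UnitAddCircle) := by
      rw [AddCircle.coe_sub, sub_eq_self]
      exact (AddCircle.coe_eq_zero_iff 1).2 ⟨round x, by simp⟩
    set y : ℝ := x - round x with hy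
    have hy2 : |y| ≤ 1 / 2 := abs_sub_round x
    change 4 * ‖(x : UnitAddCircle)‖ ≤ ‖(fourier 1 (x : UnitAddCircle) : ℂ) - 1‖
    rw [UnitAddCircle.norm_eq, ← hy, ← hround, fourier_coe_apply]
    have : Complex.exp (2 * Real.pi * Complex.I * (1 : ℤ) * y / (1 : ℝ)) =
        Complex.exp (Complex.I * ((2 * Real.pi * y : ℝ) : ℂ)) := by
      congr 1; push_cast; ring
    rw [this, Complex.norm_exp_I_mul_ofReal_sub_one, norm_mul, Real.norm_eq_abs, Real.norm_eq_abs]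
    have hpi := Real.pi_pos
    have h2 : |2 * Real.pi * y / 2| = Real.pi * |y| := by
      rw [show 2 * Real.pi * y / 2 = Real.pi * y by ring, abs_mul, abs_of_pos hpi]
    have h := Real.mul_abs_le_abs_sin (x := 2 * Real.pi * y / 2) (by rw [h2]; nlinarith)
    rw [h2] at h
    have h3 : 2 / Real.pi * (Real.pi * |y|) = 2 * |y| := by field_simp
    rw [h3] at h
    rw [abs_two]
    linarith

lemma sixteen_mul_norm_sq_le_laplaceSymbol (θ : UnitAddTorus (Fin d)) (j : Fin d) :
    16 * ‖θ j‖ ^ 2 ≤ laplaceSymbol θ := by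
  have hunit : latUnit d j = Pi.single j 1 := by
    ext i; simp [latUnit, Pi.single_apply]
  have h1 : ‖mFourier (latUnit d j) θ - 1‖ ^ 2 ≤ laplaceSymbol θ :=
    Finset.single_le_sum (f := fun j => ‖mFourier (latUnit d j) θ - 1‖ ^ 2)
      (fun _ _ => by positivity) (Finset.mem_univ j)
  rw [hunit, mFourier_single] at h1
  have h2 := four_mul_norm_le (θ j)
  nlinarith [norm_nonneg (θ j)]

lemma volume_laplaceSymbol_lt_le (μ : ℝ) :
    volume {θ : UnitAddTorus (Fin d) | laplaceSymbol θ < μ} ≤ ENNReal.ofReal (√μ / 2) ^ d := by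
  have hsub : {θ : UnitAddTorus (Fin d) | laplaceSymbol θ < μ} ⊆
      Set.pi Set.univ fun _ => Metric.closedBall (0 : UnitAddCircle) (√μ / 4) := by
    intro θ hθ j _
    rw [mem_closedBall_zero_iff]
    have := sixteen_mul_norm_sq_le_laplaceSymbol θ j
    have h4 : (4 * ‖θ j‖) ^ 2 ≤ μ := by nlinarith [hθ.out]
    linarith [Real.le_sqrt_of_sq_le h4]
  refine (measure_mono hsub).trans ?_
  rw [volume_pi_pi]
  have hball : (volume : Measure UnitAddCircle) (Metric.closedBall 0 (√μ / 4)) ≤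
      ENNReal.ofReal (√μ / 2) := by
    have h := AddCircle.volume_closedBall (1 : ℝ) (x := 0) (√μ / 4)
    rw [AddCircle.volume_eq_smul_haarAddCircle, ENNReal.ofReal_one, one_smul] at h
    refine (le_of_eq h).trans (ENNReal.ofReal_le_ofReal ((min_le_right _ _).trans ?_))
    linarith
  simpa using Finset.prod_le_pow_card Finset.univ _ _ (fun (_ : Fin d) _ => hball)

lemma inv_ofReal_le_tsum {y : ℝ} (hy : 0 ≤ y) {k : ℕ} (hk : y < 8 * (1 / 2) ^ k) :
    (ENNReal.ofReal y)⁻¹ ≤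
      ∑' i : ℕ, 2 ^ (k + i) * 4⁻¹ * (if y < 8 * (1 / 2) ^ (k + i) then 1 else 0) := by
  rcases hy.eq_or_lt with rfl | hpos
  · have htop : ∑' _ : ℕ, (4⁻¹ : ℝ≥0∞) = ⊤ := ENNReal.tsum_const_eq_top_of_ne_zero (by simp)
    refine le_top.trans (htop.symm.le.trans (ENNReal.tsum_le_tsum fun i => ?_))
    rw [if_pos (by positivity), mul_one]
    exact le_mul_of_one_le_left' (one_le_pow₀ (by norm_num))
  · have hex : ∃ i : ℕ, 8 * (1 / 2) ^ (k + i) ≤ y := by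
      obtain ⟨n, hn⟩ := exists_pow_lt_of_lt_one (show 0 < y / 8 by positivity)
        (show (1 / 2 : ℝ) < 1 by norm_num)
      refine ⟨n, ?_⟩
      have : (1 / 2 : ℝ) ^ (k + n) ≤ (1 / 2) ^ n :=
        pow_le_pow_of_le_one (by norm_num) (by norm_num) (by omega)
      linarith
    classical
    obtain ⟨i, hi⟩ : ∃ i, Nat.find hex = i + 1 :=
      Nat.exists_eq_succ_of_ne_zero fun h0 => by
        have := Nat.find_spec hex
        rw [h0, add_zero] at this
        linarith
    have hi1 : 8 * (1 / 2) ^ (k + (i + 1)) ≤ y := hi ▸ Nat.find_spec hex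
    have hi2 : y < 8 * (1 / 2) ^ (k + i) := not_le.1 (Nat.find_min hex (by omega))
    refine le_trans ?_ (ENNReal.le_tsum i)
    rw [if_pos hi2, mul_one, ← ENNReal.ofReal_inv_of_pos hpos]
    have : (2 ^ (k + i) * 4⁻¹ : ℝ≥0∞) = ENNReal.ofReal (2 ^ (k + i) * 4⁻¹) := by
      rw [ENNReal.ofReal_mul (by positivity), ENNReal.ofReal_pow (by norm_num),
        ENNReal.ofReal_inv_of_pos (by norm_num)]
      simp
    rw [this]
    refine ENNReal.ofReal_le_ofReal (inv_le_of_inv_le₀ (by positivity) ?_)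
    refine le_trans (le_of_eq ?_) hi1
    rw [← add_assoc, pow_succ, one_div, inv_pow, mul_inv, inv_inv]
    ring

lemma tsum_two_inv_pow_ite_le {y : ℝ} :
    ∑' k : ℕ, (2⁻¹ : ℝ≥0∞) ^ k * (if 8 * (1 / 2) ^ k ≤ y then 1 else 0) ≤
      4⁻¹ * ENNReal.ofReal y := by
  classical
  by_cases hex : ∃ k : ℕ, 8 * (1 / 2) ^ k ≤ y
  · set m := Nat.find hex
    have hm : 8 * (1 / 2) ^ m ≤ y := Nat.find_spec hex
    rw [← Summable.sum_add_tsum_nat_add' (k := m) ENNReal.summable, Finset.sum_eq_zero, zero_add]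
    · calc _ ≤ ∑' k : ℕ, (2⁻¹ : ℝ≥0∞) ^ m * 2⁻¹ ^ k := by
            refine ENNReal.tsum_le_tsum fun k => ?_
            rw [← pow_add, add_comm m k]
            exact mul_le_of_le_one_right' (by split_ifs <;> simp)
        _ = 4⁻¹ * ENNReal.ofReal (8 * (1 / 2) ^ m) := by
            rw [ENNReal.tsum_mul_left, ENNReal.tsum_geometric, ENNReal.one_sub_inv_two, inv_inv,
              ENNReal.ofReal_mul (by norm_num), ENNReal.ofReal_pow (by norm_num), one_div,
              ENNReal.ofReal_inv_of_pos (by norm_num), ENNReal.ofReal_ofNat, ENNReal.ofReal_ofNat,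
              ← mul_assoc, show (8 : ℝ≥0∞) = 4 * 2 by norm_num, ← mul_assoc,
              ENNReal.inv_mul_cancel (by simp) (by simp), one_mul, mul_comm]
        _ ≤ _ := by gcongr
    · intro k hk
      rw [if_neg (Nat.find_min hex (Finset.mem_range.1 hk)), mul_zero]
  · push Not at hex
    simp_rw [if_neg (hex _).not_ge]
    simp

/-- The decay ratio `2^{-d/2}` of the measure of the dyadic sublevel sets of the symbol. -/
def dyadicRatio (d : ℕ) : ℝ≥0∞ := ENNReal.ofReal √(1 / 2) ^ d

lemma two_mul_dyadicRatio_lt_one (hd : 3 ≤ d) : 2 * dyadicRatio d < 1 := by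
  have hs : √(1 / 2 : ℝ) ^ 2 = 1 / 2 := Real.sq_sqrt (by norm_num)
  have h0 : 0 ≤ √(1 / 2 : ℝ) := Real.sqrt_nonneg _
  have h1 : √(1 / 2 : ℝ) < 1 := by nlinarith
  have h2 : √(1 / 2 : ℝ) ^ d ≤ √(1 / 2 : ℝ) ^ 3 := pow_le_pow_of_le_one h0 h1.le hd
  rw [dyadicRatio, ← ENNReal.ofReal_pow h0, ← ENNReal.ofReal_ofNat 2,
    ← ENNReal.ofReal_mul (by norm_num), ENNReal.ofReal_lt_one]
  nlinarith

lemma volume_laplaceSymbol_lt_dyadic_le (j : ℕ) :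
    volume {θ : UnitAddTorus (Fin d) | laplaceSymbol θ < 8 * (1 / 2) ^ j} ≤
      ENNReal.ofReal √2 ^ d * dyadicRatio d ^ j := by
  refine (volume_laplaceSymbol_lt_le _).trans (le_of_eq ?_)
  have : √(8 * (1 / 2) ^ j) / 2 = √2 * √(1 / 2) ^ j := by
    have hpow : √((1 / 2) ^ j) = √(1 / 2 : ℝ) ^ j := by
      rw [Real.sqrt_eq_iff_mul_self_eq (by positivity) (by positivity), ← mul_pow,
        Real.mul_self_sqrt (by norm_num)]
    rw [Real.sqrt_mul (by norm_num), hpow, show (8 : ℝ) = 2 ^ 2 * 2 by norm_num, Real.sqrt_mul (by norm_num),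
      Real.sqrt_sq (by norm_num)]
    ring
  rw [this, ENNReal.ofReal_mul (by positivity), mul_pow, ENNReal.ofReal_pow (by positivity),
    dyadicRatio, ← pow_mul, ← pow_mul, mul_comm j d]

lemma measurableSet_laplaceSymbol_lt (μ : ℝ) :
    MeasurableSet {θ : UnitAddTorus (Fin d) | laplaceSymbol θ < μ} :=
  measurableSet_lt continuous_laplaceSymbol.measurable measurable_const

/-- The constant in the bound for the integral of the Green symbol over a sublevel set. -/
def greenConst (d : ℕ) : ℝ≥0∞ := 4⁻¹ * ENNReal.ofReal √2 ^ d * (1 - 2 * dyadicRatio d)⁻¹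

lemma greenConst_ne_top (hd : 3 ≤ d) : greenConst d ≠ ⊤ := by
  have := tsub_pos_of_lt (two_mul_dyadicRatio_lt_one hd)
  refine ENNReal.mul_ne_top (ENNReal.mul_ne_top (by simp) (by simp)) ?_
  exact ENNReal.inv_ne_top.2 this.ne'

lemma setLIntegral_inv_laplaceSymbol_le (k : ℕ) :
    ∫⁻ θ in {θ : UnitAddTorus (Fin d) | laplaceSymbol θ < 8 * (1 / 2) ^ k},
      (ENNReal.ofReal (laplaceSymbol θ))⁻¹ ≤ greenConst d * (2 * dyadicRatio d) ^ k := by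
  have hmeas : ∀ i : ℕ, Measurable fun θ : UnitAddTorus (Fin d) =>
      (if laplaceSymbol θ < 8 * (1 / 2) ^ (k + i) then 1 else 0 : ℝ≥0∞) := fun i =>
    Measurable.ite (measurableSet_laplaceSymbol_lt _) measurable_const measurable_const
  calc _ ≤ ∫⁻ θ in {θ : UnitAddTorus (Fin d) | laplaceSymbol θ < 8 * (1 / 2) ^ k},
        ∑' i : ℕ, 2 ^ (k + i) * 4⁻¹ * (if laplaceSymbol θ < 8 * (1 / 2) ^ (k + i) then 1 else 0) :=
        setLIntegral_mono_ae' (measurableSet_laplaceSymbol_lt _)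
          (ae_of_all _ fun θ hθ => inv_ofReal_le_tsum (laplaceSymbol_nonneg θ) hθ)
    _ ≤ ∫⁻ θ : UnitAddTorus (Fin d),
        ∑' i : ℕ, 2 ^ (k + i) * 4⁻¹ * (if laplaceSymbol θ < 8 * (1 / 2) ^ (k + i) then 1 else 0) :=
        setLIntegral_le_lintegral _ _
    _ = ∑' i : ℕ, 2 ^ (k + i) * 4⁻¹ *
        volume {θ : UnitAddTorus (Fin d) | laplaceSymbol θ < 8 * (1 / 2) ^ (k + i)} := by
        rw [lintegral_tsum fun i => ((hmeas i).const_mul _).aemeasurable]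
        refine tsum_congr fun i => ?_
        rw [lintegral_const_mul _ (hmeas i), ← lintegral_indicator_one
          (measurableSet_laplaceSymbol_lt _)]
        rfl
    _ ≤ ∑' i : ℕ, 2 ^ (k + i) * 4⁻¹ * (ENNReal.ofReal √2 ^ d * dyadicRatio d ^ (k + i)) := by
        gcongr
        exact volume_laplaceSymbol_lt_dyadic_le _
    _ = ∑' i : ℕ, 4⁻¹ * ENNReal.ofReal √2 ^ d * (2 * dyadicRatio d) ^ k *
        (2 * dyadicRatio d) ^ i := by
        refine tsum_congr fun i => ?_
        rw [pow_add, pow_add, mul_pow, mul_pow]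
        ring
    _ = _ := by
        rw [ENNReal.tsum_mul_left, ENNReal.tsum_geometric, greenConst]
        ring

lemma bV_le_tsum_dyadic {V : (Fin d → ℤ) → ℝ} {s : ℝ} (hs : 0 < s) {u : (Fin d → ℤ) → ℂ}
    (hu : ∀ x, s < V x → u x = 0) :
    bV V u ≤ ENNReal.ofReal s * ∑' k : ℕ, 2⁻¹ ^ k *
      ∑' x, {x | s * (1 / 2) ^ (k + 1) < V x}.indicator (fun x => ‖u x‖ₑ ^ 2) x := by
  simp_rw [← ENNReal.tsum_mul_left]
  rw [ENNReal.tsum_comm]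
  refine ENNReal.tsum_le_tsum fun x => ?_
  by_cases hVs : s < V x
  · simp [hu x hVs]
  by_cases hV0 : V x ≤ 0
  · simp [ENNReal.ofReal_of_nonpos hV0]
  push Not at hVs hV0
  obtain ⟨k, hk1, hk2⟩ := exists_nat_pow_near_of_lt_one (div_pos hV0 hs)
    ((div_le_one hs).2 hVs) (show (0 : ℝ) < 1 / 2 by norm_num) (by norm_num)
  rw [lt_div_iff₀ hs, mul_comm] at hk1
  rw [div_le_iff₀ hs, mul_comm] at hk2
  refine le_trans ?_ (ENNReal.le_tsum k)
  rw [Set.indicator_of_mem (by exact hk1), ← mul_assoc]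
  have h2 : ENNReal.ofReal s * 2⁻¹ ^ k = ENNReal.ofReal (s * (1 / 2) ^ k) := by
    rw [ENNReal.ofReal_mul hs.le, ENNReal.ofReal_pow (by norm_num), one_div,
      ENNReal.ofReal_inv_of_pos (by norm_num), ENNReal.ofReal_ofNat]
  rw [h2]
  exact mul_le_mul_left (ENNReal.ofReal_le_ofReal hk2) _

lemma tsum_setLIntegral_le (u : (Fin d → ℤ) →₀ ℂ) :
    ∑' k : ℕ, 2⁻¹ ^ k * ∫⁻ θ in {θ : UnitAddTorus (Fin d) | laplaceSymbol θ < 8 * (1 / 2) ^ k}ᶜ,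
      ‖trigPoly u θ‖ₑ ^ 2 ≤ 4⁻¹ * Q0 u := by
  have hm : Measurable fun θ => ‖trigPoly u θ‖ₑ ^ 2 := by
    have := (trigPoly u).continuous.measurable
    fun_prop
  have hm' : ∀ k : ℕ, Measurable fun θ : UnitAddTorus (Fin d) =>
      (if 8 * (1 / 2) ^ k ≤ laplaceSymbol θ then 1 else 0 : ℝ≥0∞) := fun k =>
    Measurable.ite (measurableSet_le measurable_const continuous_laplaceSymbol.measurable)
      measurable_const measurable_const
  calc _ = ∑' k : ℕ, ∫⁻ θ, 2⁻¹ ^ k *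
        (if 8 * (1 / 2) ^ k ≤ laplaceSymbol θ then 1 else 0) * ‖trigPoly u θ‖ₑ ^ 2 := by
        refine tsum_congr fun k => ?_
        rw [← lintegral_indicator (measurableSet_laplaceSymbol_lt _).compl,
          ← lintegral_const_mul _ (hm.indicator (measurableSet_laplaceSymbol_lt _).compl)]
        congr 1 with θ
        by_cases h : 8 * (1 / 2) ^ k ≤ laplaceSymbol θ
        · rw [Set.indicator_of_mem (by simpa using h), if_pos h, mul_one]
        · rw [Set.indicator_of_notMem (by simpa using h), if_neg h]
          simp
    _ = ∫⁻ θ, (∑' k : ℕ, 2⁻¹ ^ k * (if 8 * (1 / 2) ^ k ≤ laplaceSymbol θ then 1 else 0)) *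
        ‖trigPoly u θ‖ₑ ^ 2 := by
        simp_rw [← ENNReal.tsum_mul_right]
        exact (lintegral_tsum fun k => (((hm' k).const_mul _).mul hm).aemeasurable).symm
    _ ≤ ∫⁻ θ, 4⁻¹ * (ENNReal.ofReal (laplaceSymbol θ) * ‖trigPoly u θ‖ₑ ^ 2) := by
        refine lintegral_mono fun θ => ?_
        rw [← mul_assoc]
        exact mul_le_mul_left tsum_two_inv_pow_ite_le _
    _ = _ := by
        rw [Q0_eq_lintegral, lintegral_const_mul]
        exact (continuous_laplaceSymbol.measurable.ennreal_ofReal).mul hm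

lemma one_le_tsum_low_add_half {V : (Fin d → ℤ) → ℝ} {s : ℝ} (hs : 0 < s)
    {u : (Fin d → ℤ) →₀ ℂ} (hu : ∀ x, s < V x → u x = 0) (hQ : Q0 u = 1)
    (hV : ENNReal.ofReal s * Q0 u ≤ bV V u) :
    1 ≤ ∑' k : ℕ, 2⁻¹ ^ k * ∑' x, {x | s * (1 / 2) ^ (k + 1) < V x}.indicator
      (fun x => 2 * ‖mFourierCoeff ({θ : UnitAddTorus (Fin d) |
        laplaceSymbol θ < 8 * (1 / 2) ^ k}.indicator (trigPoly u)) x‖ₑ ^ 2) x + 2⁻¹ := by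
  have h1 := hV.trans (bV_le_tsum_dyadic hs hu)
  rw [ENNReal.mul_le_mul_iff_right (by simpa using hs) (by simp), hQ] at h1
  refine h1.trans ?_
  have hhalf : (2⁻¹ : ℝ≥0∞) = 2 * (4⁻¹ * Q0 u) := by
    rw [hQ, mul_one, show (4 : ℝ≥0∞) = 2 * 2 by norm_num,
      ENNReal.mul_inv (by simp) (by simp), ← mul_assoc, ENNReal.mul_inv_cancel (by simp) (by simp),
      one_mul]
  refine le_trans ?_ (add_le_add_right
    ((mul_le_mul_right (tsum_setLIntegral_le u) 2).trans_eq hhalf.symm) _)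
  rw [← ENNReal.tsum_mul_left, ← ENNReal.tsum_add]
  refine ENNReal.tsum_le_tsum fun k => ?_
  rw [mul_left_comm, ← mul_add, ← tsum_enorm_mFourierCoeff_indicator_sq u
    (measurableSet_laplaceSymbol_lt _).compl]
  refine mul_le_mul_right ?_ _
  rw [← ENNReal.tsum_mul_left, ← ENNReal.tsum_add]
  gcongr with x
  by_cases hx : x ∈ {x | s * (1 / 2) ^ (k + 1) < V x}
  · rw [Set.indicator_of_mem hx, Set.indicator_of_mem hx]
    exact enorm_sq_le_mFourierCoeff_indicator u (measurableSet_laplaceSymbol_lt _) x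
  · rw [Set.indicator_of_notMem hx]
    exact zero_le

lemma natCast_le_of_orthonormal {V : (Fin d → ℤ) → ℝ} {s : ℝ} (hs : 0 < s) {N : ℕ}
    {u : Fin N → (Fin d → ℤ) →₀ ℂ} (hu : Orthonormal ℂ fun i => energyMap (u i))
    (hvanish : ∀ i x, s < V x → u i x = 0)
    (hV : ∀ i, ENNReal.ofReal s * Q0 (u i) ≤ bV V (u i)) :
    (N : ℝ≥0∞) ≤ 4 * greenConst d *
      ∑' k : ℕ, dyadicRatio d ^ k * (nuCount d V (s * (1 / 2) ^ (k + 1)) : ℝ≥0∞) := by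
  have hQ : ∀ i, Q0 (u i) = 1 := fun i => by
    rw [← enorm_energyMap_sq, ← ofReal_norm, hu.1 i]
    simp
  have hsum := Finset.sum_le_sum fun i (_ : i ∈ Finset.univ) =>
    one_le_tsum_low_add_half hs (hvanish i) (hQ i) (hV i)
  rw [Finset.sum_add_distrib, ← Summable.tsum_finsetSum (fun _ _ => ENNReal.summable)] at hsum
  simp_rw [← Finset.mul_sum] at hsum
  simp only [Finset.sum_const, Finset.card_univ, Fintype.card_fin, nsmul_eq_mul, mul_one] at hsum
  have hlow : ∀ k : ℕ, (2⁻¹ : ℝ≥0∞) ^ k * ∑ i, ∑' x,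
      {x | s * (1 / 2) ^ (k + 1) < V x}.indicator
        (fun x => 2 * ‖mFourierCoeff ({θ : UnitAddTorus (Fin d) |
          laplaceSymbol θ < 8 * (1 / 2) ^ k}.indicator (trigPoly (u i))) x‖ₑ ^ 2) x ≤
      2 * greenConst d * (dyadicRatio d ^ k *
        (nuCount d V (s * (1 / 2) ^ (k + 1)) : ℝ≥0∞)) := by
    intro k
    rw [← Summable.tsum_finsetSum (fun _ _ => ENNReal.summable)]
    calc _ ≤ (2⁻¹ : ℝ≥0∞) ^ k * ∑' x, {x | s * (1 / 2) ^ (k + 1) < V x}.indicator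
          (fun _ => 2 * (greenConst d * (2 * dyadicRatio d) ^ k)) x := by
          gcongr with x
          by_cases hx : x ∈ {x | s * (1 / 2) ^ (k + 1) < V x}
          · simp_rw [Set.indicator_of_mem hx]
            rw [← Finset.mul_sum]
            gcongr
            exact (sum_enorm_mFourierCoeff_indicator_sq_le hu
              (measurableSet_laplaceSymbol_lt _) x).trans (setLIntegral_inv_laplaceSymbol_le k)
          · simp_rw [Set.indicator_of_notMem hx]
            simp
      _ = (2⁻¹ * 2) ^ k * (2 * greenConst d * (dyadicRatio d ^ k *
          (nuCount d V (s * (1 / 2) ^ (k + 1)) : ℝ≥0∞))) := by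
          rw [← tsum_subtype, ENNReal.tsum_set_const, nuCount, mul_pow, mul_pow]
          ring
      _ = _ := by rw [ENNReal.inv_mul_cancel (by simp) (by simp), one_pow, one_mul]
  have hmain : (N : ℝ≥0∞) ≤ 2 * greenConst d * ∑' k : ℕ, dyadicRatio d ^ k *
      (nuCount d V (s * (1 / 2) ^ (k + 1)) : ℝ≥0∞) + N * 2⁻¹ := by
    rw [← ENNReal.tsum_mul_left]
    exact hsum.trans (add_le_add_left (ENNReal.tsum_le_tsum hlow) _)
  set T := ∑' k : ℕ, dyadicRatio d ^ k * (nuCount d V (s * (1 / 2) ^ (k + 1)) : ℝ≥0∞)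
  have hN : (N : ℝ≥0∞) = N * 2⁻¹ + N * 2⁻¹ := by
    rw [← mul_add, ENNReal.inv_two_add_inv_two, mul_one]
  have hfin : (N : ℝ≥0∞) * 2⁻¹ ≠ ⊤ := ENNReal.mul_ne_top (by simp) (by simp)
  have hhalf : (N : ℝ≥0∞) * 2⁻¹ ≤ 2 * greenConst d * T :=
    (ENNReal.add_le_add_iff_right hfin).1 (hN.symm.trans_le hmain)
  calc (N : ℝ≥0∞) = N * 2⁻¹ + N * 2⁻¹ := hN
    _ ≤ 2 * greenConst d * T + 2 * greenConst d * T := add_le_add hhalf hhalf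
    _ = _ := by ring

lemma Q0_ne_zero (hd : 0 < d) {u : (Fin d → ℤ) →₀ ℂ} (hu : u ≠ 0) : Q0 u ≠ 0 := by
  intro hQ
  obtain ⟨x, hx⟩ := Finsupp.ne_iff.1 hu
  let j : Fin d := ⟨0, hd⟩
  have hstep : ∀ y, u (y + latUnit d j) = u y := by
    intro y
    have h := (Finset.sum_eq_zero_iff.1 (ENNReal.tsum_eq_zero.1 hQ y)) j (Finset.mem_univ j)
    simpa [sub_eq_zero] using h
  have hiter : ∀ n : ℕ, u (x + n • latUnit d j) = u x := by
    intro n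
    induction n with
    | zero => simp
    | succ n ih => rw [succ_nsmul, ← add_assoc, hstep, ih]
  have hinj : Function.Injective fun n : ℕ => x + n • latUnit d j := by
    intro m n hmn
    have := congrFun hmn j
    simpa [latUnit] using this
  refine Set.infinite_of_injective_forall_mem hinj (s := (u.support : Set (Fin d → ℤ)))
    (fun n => ?_) u.support.finite_toSet
  rw [Finset.mem_coe, Finsupp.mem_support_iff, hiter n]
  simpa using hx

lemma energyMap_injective (hd : 0 < d) : Function.Injective (energyMap (d := d)) := by
  rw [injective_iff_map_eq_zero]
  intro u hu
  by_contra h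
  refine Q0_ne_zero hd h ?_
  rw [← enorm_energyMap_sq, hu]
  simp

lemma finrank_le_of_vanish (hd : 0 < d) {V : (Fin d → ℤ) → ℝ} {s : ℝ} (hs : 0 < s)
    (K : Submodule ℂ ((Fin d → ℤ) →₀ ℂ)) [FiniteDimensional ℂ K]
    (hvanish : ∀ u ∈ K, ∀ x, s < V x → u x = 0)
    (hV : ∀ u ∈ K, ENNReal.ofReal s * Q0 u ≤ bV V u) :
    (Module.finrank ℂ K : ℝ≥0∞) ≤ 4 * greenConst d *
      ∑' k : ℕ, dyadicRatio d ^ k * (nuCount d V (s * (1 / 2) ^ (k + 1)) : ℝ≥0∞) := by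
  let b := stdOrthonormalBasis ℂ (K.map energyMap)
  have hb : ∀ i, ∃ u ∈ K, energyMap u = b i := fun i => Submodule.mem_map.1 (b i).2
  choose u huK hu using hb
  have hon : Orthonormal ℂ fun i => energyMap (u i) := by
    simp_rw [hu]
    exact b.orthonormal.comp_linearIsometry (K.map energyMap).subtypeₗᵢ
  rw [(Submodule.equivMapOfInjective energyMap (energyMap_injective hd) K).finrank_eq]
  exact natCast_le_of_orthonormal hs hon (fun i => hvanish _ (huK i)) fun i => hV _ (huK i)

lemma finrank_le_card_add_finrank_vanish {α : Type*} (K : Submodule ℂ (α →₀ ℂ))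
    [FiniteDimensional ℂ K] (F : Finset α) :
    ∃ K' ≤ K, (∀ u ∈ K', ∀ x ∈ F, u x = 0) ∧
      Module.finrank ℂ K ≤ F.card + Module.finrank ℂ K' := by
  let R : K →ₗ[ℂ] (F → ℂ) := LinearMap.pi fun x => Finsupp.lapply x.1 ∘ₗ K.subtype
  refine ⟨(LinearMap.ker R).map K.subtype, Submodule.map_subtype_le _ _, ?_, ?_⟩
  · rintro _ ⟨v, hv, rfl⟩ x hx
    exact congrFun (LinearMap.mem_ker.1 hv) ⟨x, hx⟩
  · have hrank := LinearMap.finrank_range_add_finrank_ker (K := ℂ) (V := K) (V₂ := F → ℂ) R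
    have hle : Module.finrank ℂ (LinearMap.range R) ≤ F.card := by
      simpa using Submodule.finrank_le (LinearMap.range R)
    rw [← (Submodule.equivMapOfInjective K.subtype K.injective_subtype
      (LinearMap.ker R)).finrank_eq]
    omega

lemma nCount_le (hd : 0 < d) (V : (Fin d → ℤ) → ℝ) {s : ℝ} (hs : 0 < s) :
    (nCount d V s : ℝ≥0∞) ≤ nuCount d V s + 4 * greenConst d *
      ∑' k : ℕ, dyadicRatio d ^ k * (nuCount d V (s * (1 / 2) ^ (k + 1)) : ℝ≥0∞) := by
  by_cases hfin : {x | s < V x}.Finite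
  swap
  · rw [nuCount, Set.encard_eq_top hfin]
    simp
  rw [nCount, ENat.toENNReal_iSup]
  refine iSup_le fun ⟨L, hL, hLfin, hadm⟩ => ?_
  let ι : ((Fin d → ℤ) →₀ ℂ) →ₗ[ℂ] ((Fin d → ℤ) → ℂ) := Finsupp.lcoeFun
  have hι : Function.Injective ι := DFunLike.coe_injective
  have hmap : (L.comap ι).map ι = L := by
    refine Submodule.map_comap_eq_self fun u hu => ?_
    exact ⟨Finsupp.ofSupportFinite u (hL u hu), rfl⟩
  let e : L.comap ι ≃ₗ[ℂ] L :=
    (Submodule.equivMapOfInjective ι hι (L.comap ι)).trans (LinearEquiv.ofEq _ _ hmap)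
  have : FiniteDimensional ℂ (L.comap ι) := e.symm.finiteDimensional
  obtain ⟨K, hKL, hK, hcard⟩ := finrank_le_card_add_finrank_vanish (L.comap ι) hfin.toFinset
  have : FiniteDimensional ℂ K := Submodule.finiteDimensional_of_le hKL
  have hK' := finrank_le_of_vanish hd (V := V) hs K (fun u hu x hx => hK u hu x (by simpa using hx))
    fun u hu => by
      by_cases h0 : u = 0
      · simp [h0, Q0]
      · exact (hadm u (hKL hu) fun h => h0 (DFunLike.coe_injective h)).le
  rw [e.finrank_eq] at hcard
  rw [nuCount, hfin.encard_eq_coe_toFinset_card]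
  refine le_trans ?_ (add_le_add_right hK' _)
  simpa using (by exact_mod_cast hcard : (Module.finrank ℂ L : ℝ≥0∞) ≤ _ + _)

end Torus

lemma Q0_le {d : ℕ} (u : (Fin d → ℤ) → ℂ) : Q0 u ≤ 4 * d * ∑' x, (‖u x‖₊ : ℝ≥0∞) ^ 2 := by
  unfold Q0
  rw [Summable.tsum_finsetSum (fun _ _ => ENNReal.summable)]
  have hshift : ∀ j, ∑' x, (‖u (x + latUnit d j)‖₊ : ℝ≥0∞) ^ 2 = ∑' x, (‖u x‖₊ : ℝ≥0∞) ^ 2 :=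
    fun j => (Equiv.addRight (latUnit d j)).tsum_eq fun x => (‖u x‖₊ : ℝ≥0∞) ^ 2
  have hj : ∀ j, ∑' x, (‖u (x + latUnit d j) - u x‖₊ : ℝ≥0∞) ^ 2 ≤
      4 * ∑' x, (‖u x‖₊ : ℝ≥0∞) ^ 2 := by
    intro j
    calc _ ≤ ∑' x, (2 * (‖u (x + latUnit d j)‖₊ : ℝ≥0∞) ^ 2 + 2 * (‖u x‖₊ : ℝ≥0∞) ^ 2) := by
          refine ENNReal.tsum_le_tsum fun x => ?_
          norm_cast
          rw [← NNReal.coe_le_coe]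
          push_cast
          nlinarith [norm_sub_le (u (x + latUnit d j)) (u x), norm_nonneg (u (x + latUnit d j)),
            norm_nonneg (u x), norm_nonneg (u (x + latUnit d j) - u x),
            sq_nonneg (‖u (x + latUnit d j)‖ - ‖u x‖)]
      _ = 2 * ∑' x, (‖u x‖₊ : ℝ≥0∞) ^ 2 + 2 * ∑' x, (‖u x‖₊ : ℝ≥0∞) ^ 2 := by
          rw [ENNReal.tsum_add, ENNReal.tsum_mul_left, ENNReal.tsum_mul_left, hshift]
      _ = _ := by ring
  refine (Finset.sum_le_sum fun j _ => hj j).trans (le_of_eq ?_)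
  simp only [Finset.sum_const, Finset.card_univ, Fintype.card_fin, nsmul_eq_mul]
  ring

lemma nuCount_le_nCount (d : ℕ) (V : (Fin d → ℤ) → ℝ) {s : ℝ} (hs : 0 < s) :
    nuCount d V (4 * d * s) ≤ nCount d V s := by
  rw [← ENat.forall_natCast_le_iff_le]
  intro n hn
  obtain ⟨F, hFV, hFn⟩ := Set.exists_subset_encard_eq hn
  have hF : F.Finite := Set.finite_of_encard_eq_coe hFn
  have : Fintype F := hF.fintype
  let E : (F → ℂ) →ₗ[ℂ] ((Fin d → ℤ) → ℂ) := Function.ExtendByZero.linearMap ℂ Subtype.val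
  have hE : Function.Injective E := by
    intro f g hfg
    funext x
    have := congrFun hfg x.1
    simpa [E, Subtype.val_injective.extend_apply] using this
  have hsupp : ∀ u ∈ LinearMap.range E, Function.support u ⊆ F := by
    rintro _ ⟨f, rfl⟩ x hx
    by_contra hxF
    refine hx (Function.extend_apply' _ _ _ ?_)
    rintro ⟨y, rfl⟩
    exact hxF y.2
  have hrank : Module.finrank ℂ (LinearMap.range E) = n := by
    rw [LinearMap.finrank_range_of_inj hE, Module.finrank_fintype_fun_eq_card]
    rw [← Set.coe_fintypeCard] at hFn
    exact_mod_cast hFn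
  rw [← hrank]
  refine le_iSup_of_le (⟨LinearMap.range E, fun u hu => hF.subset (hsupp u hu), inferInstance,
    fun u hu hu0 => ?_⟩ : {L : Submodule ℂ ((Fin d → ℤ) → ℂ) // _}) le_rfl
  obtain ⟨x, hx⟩ := Function.ne_iff.1 hu0
  have hc : ENNReal.ofReal s * (4 * d) = ENNReal.ofReal (4 * d * s) := by
    rw [ENNReal.ofReal_mul (by positivity), ENNReal.ofReal_mul (by positivity)]
    simp [mul_comm]
  calc ENNReal.ofReal s * Q0 u ≤ ENNReal.ofReal s * (4 * d * ∑' x, (‖u x‖₊ : ℝ≥0∞) ^ 2) := by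
        gcongr
        exact Q0_le u
    _ = ∑' x, ENNReal.ofReal (4 * d * s) * (‖u x‖₊ : ℝ≥0∞) ^ 2 := by
        rw [← mul_assoc, hc, ENNReal.tsum_mul_left]
    _ < bV V u := by
        refine ENNReal.tsum_lt_tsum (i := x) ?_ (fun y => ?_) ?_
        · rw [tsum_eq_sum (s := hF.toFinset)]
          · exact ENNReal.sum_ne_top.2 fun y _ => by finiteness
          · intro y hy
            have : u y = 0 := by
              by_contra h
              exact hy (hF.mem_toFinset.2 (hsupp u hu h))
            simp [this]
        · by_cases hy : u y = 0
          · simp [hy]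
          · gcongr
            exact (hFV (hsupp u hu hy)).le
        · refine (ENNReal.mul_lt_mul_iff_left ?_ (by finiteness)).2 ?_
          · simpa using hx
          · exact (ENNReal.ofReal_lt_ofReal_iff_of_nonneg (by positivity)).2 (hFV (hsupp u hu hx))

lemma limsup_comp_mul_le {κ : ℝ} (hκ : 0 < κ) (G : ℝ → ℝ≥0∞) :
    limsup (fun t => G (κ * t)) (𝓝[>] 0) ≤ limsup G (𝓝[>] 0) := by
  have hmap : Tendsto (fun t => κ * t) (𝓝[>] 0) (𝓝[>] 0) := by
    refine tendsto_nhdsWithin_iff.2 ⟨?_, ?_⟩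
    · have : Tendsto (fun t => κ * t) (𝓝 0) (𝓝 (κ * 0)) := tendsto_id.const_mul κ
      rw [mul_zero] at this
      exact this.mono_left nhdsWithin_le_nhds
    · filter_upwards [self_mem_nhdsWithin] with t ht
      exact mul_pos hκ ht
  exact limsup_le_limsup_of_le (u := G) hmap

lemma ofReal_mul_limsup_nuCount_le {d : ℕ} (hd : 0 < d) (q : ℝ) (V : (Fin d → ℤ) → ℝ) :
    ENNReal.ofReal ((4 * d : ℝ)⁻¹ ^ q) *
        limsup (fun s : ℝ => ENNReal.ofReal (s ^ q) * (nuCount d V s : ℝ≥0∞)) (𝓝[>] 0) ≤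
      limsup (fun s : ℝ => ENNReal.ofReal (s ^ q) * (nCount d V s : ℝ≥0∞)) (𝓝[>] 0) := by
  have hκ : (0 : ℝ) < (4 * d : ℝ)⁻¹ := by positivity
  rw [← ENNReal.limsup_const_mul_of_ne_top ENNReal.ofReal_ne_top]
  refine le_trans (limsup_le_limsup ?_) (limsup_comp_mul_le hκ _)
  filter_upwards [self_mem_nhdsWithin] with t (ht : 0 < t)
  rw [← mul_assoc, ← ENNReal.ofReal_mul (by positivity), ← Real.mul_rpow hκ.le ht.le]
  gcongr
  have h := nuCount_le_nCount d V (mul_pos hκ ht)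
  rwa [mul_inv_cancel_left₀ (by positivity)] at h

/-- The constant in the upper bound for the limsup of the weighted counting function. -/
def upperConst (d : ℕ) (q : ℝ) : ℝ≥0∞ :=
  1 + 4 * greenConst d * ∑' k : ℕ, dyadicRatio d ^ k * ENNReal.ofReal (2 ^ q) ^ (k + 1)

lemma dyadicRatio_mul_ofReal_lt_one {d : ℕ} {q : ℝ} (hq : q < d / 2) :
    dyadicRatio d * ENNReal.ofReal (2 ^ q) < 1 := by
  have h0 : (0 : ℝ) ≤ √(1 / 2) := Real.sqrt_nonneg _
  rw [dyadicRatio, ← ENNReal.ofReal_pow h0, ← ENNReal.ofReal_mul (by positivity),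
    ENNReal.ofReal_lt_one]
  have h : √(1 / 2) ^ d = (2 : ℝ) ^ (-(d / 2) : ℝ) := by
    rw [Real.sqrt_eq_rpow, one_div, Real.inv_rpow (by norm_num), ← Real.rpow_neg (by norm_num),
      ← Real.rpow_natCast, ← Real.rpow_mul (by norm_num)]
    congr 1
    ring
  rw [h, ← Real.rpow_add (by norm_num)]
  exact Real.rpow_lt_one_of_one_lt_of_neg (by norm_num) (by linarith)

lemma upperConst_ne_top {d : ℕ} (hd : 3 ≤ d) {q : ℝ} (hq : q < d / 2) : upperConst d q ≠ ⊤ := by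
  have hsum : ∑' k : ℕ, dyadicRatio d ^ k * ENNReal.ofReal (2 ^ q) ^ (k + 1) ≠ ⊤ := by
    simp_rw [pow_succ, ← mul_assoc, ← mul_pow]
    rw [ENNReal.tsum_mul_right, ENNReal.tsum_geometric]
    have := tsub_pos_of_lt (dyadicRatio_mul_ofReal_lt_one hq)
    exact ENNReal.mul_ne_top (ENNReal.inv_ne_top.2 this.ne') ENNReal.ofReal_ne_top
  have := greenConst_ne_top hd
  unfold upperConst
  finiteness

lemma limsup_nCount_le {d : ℕ} (hd : 3 ≤ d) {q : ℝ} (hq : q < d / 2) (V : (Fin d → ℤ) → ℝ) :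
    limsup (fun s : ℝ => ENNReal.ofReal (s ^ q) * (nCount d V s : ℝ≥0∞)) (𝓝[>] 0) ≤
      upperConst d q *
        limsup (fun s : ℝ => ENNReal.ofReal (s ^ q) * (nuCount d V s : ℝ≥0∞)) (𝓝[>] 0) := by
  have h0 : upperConst d q ≠ 0 := (zero_lt_one.trans_le le_self_add).ne'
  rw [mul_comm, ← ENNReal.div_le_iff h0 (upperConst_ne_top hd hq)]
  refine le_of_forall_gt_imp_ge_of_dense fun K hK => ?_
  rw [ENNReal.div_le_iff h0 (upperConst_ne_top hd hq)]
  obtain ⟨δ, hδ, hF⟩ := mem_nhdsGT_iff_exists_Ioo_subset.1 (eventually_lt_of_limsup_lt hK)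
  have hbound : ∀ s ∈ Set.Ioo 0 δ, ENNReal.ofReal (s ^ q) * (nuCount d V s : ℝ≥0∞) ≤ K :=
    fun s hs => le_of_lt (hF hs)
  refine limsup_le_of_le (h := ?_)
  filter_upwards [Ioo_mem_nhdsGT hδ] with s hs
  have hs0 : 0 < s := hs.1
  have hterm : ∀ k : ℕ, ENNReal.ofReal (s ^ q) * (nuCount d V (s * (1 / 2) ^ (k + 1)) : ℝ≥0∞) ≤
      ENNReal.ofReal (2 ^ q) ^ (k + 1) * K := by
    intro k
    have hpow : s ^ q = (2 ^ q) ^ (k + 1) * (s * (1 / 2) ^ (k + 1)) ^ q := by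
      rw [Real.mul_rpow hs0.le (by positivity), ← Real.rpow_pow_comm (by norm_num), mul_left_comm,
        ← mul_pow, ← Real.mul_rpow (by norm_num) (by norm_num)]
      norm_num
    rw [hpow, ENNReal.ofReal_mul (by positivity), ENNReal.ofReal_pow (by positivity), mul_assoc]
    gcongr
    refine hbound _ ⟨by positivity, lt_of_le_of_lt ?_ hs.2⟩
    exact mul_le_of_le_one_right hs0.le (pow_le_one₀ (by norm_num) (by norm_num))
  calc ENNReal.ofReal (s ^ q) * (nCount d V s : ℝ≥0∞)
      ≤ ENNReal.ofReal (s ^ q) * (nuCount d V s + 4 * greenConst d *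
          ∑' k : ℕ, dyadicRatio d ^ k * (nuCount d V (s * (1 / 2) ^ (k + 1)) : ℝ≥0∞)) := by
        gcongr
        exact nCount_le (by omega) V hs0
    _ = ENNReal.ofReal (s ^ q) * nuCount d V s + 4 * greenConst d *
          ∑' k : ℕ, dyadicRatio d ^ k *
            (ENNReal.ofReal (s ^ q) * (nuCount d V (s * (1 / 2) ^ (k + 1)) : ℝ≥0∞)) := by
        simp_rw [mul_left_comm (dyadicRatio d ^ _), ENNReal.tsum_mul_left]
        ring
    _ ≤ K + 4 * greenConst d *
          ∑' k : ℕ, dyadicRatio d ^ k * (ENNReal.ofReal (2 ^ q) ^ (k + 1) * K) := by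
        refine add_le_add (hbound s hs) (mul_le_mul_right (ENNReal.tsum_le_tsum fun k => ?_) _)
        exact mul_le_mul_right (hterm k) _
    _ = K * upperConst d q := by
        simp_rw [upperConst, ← mul_assoc (dyadicRatio d ^ _), ENNReal.tsum_mul_right]
        ring

lemma tendsto_zero_iff_limsup_eq_zero {α : Type*} {l : Filter α} [l.NeBot] {f : α → ℝ≥0∞} :
    Tendsto f l (𝓝 0) ↔ limsup f l = 0 :=
  ⟨fun h => h.limsup_eq, fun h =>
    tendsto_of_le_liminf_of_limsup_le zero_le h.le⟩

/-- for `0 < q < d/2` and `V ∈ ℓ_{q,w}`, two-sided comparison of the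
limsups of `s^q n(s,V)` and `s^q ν(s,V)` as `s → 0⁺`; in particular
`s^q n(s,V) → 0` iff `s^q ν(s,V) → 0`. -/
theorem limsup_two_sided (d : ℕ) (hd : 3 ≤ d) (q : ℝ) (hq : 0 < q)
    (hq' : q < (d : ℝ) / 2) :
    ∃ c₀ c₁ : ℝ, 0 < c₀ ∧ 0 < c₁ ∧
      ∀ V : (Fin d → ℤ) → ℝ, (∀ x, 0 ≤ V x) →
        (⨆ t : {t : ℝ // 0 < t},
          ENNReal.ofReal (t.1 ^ q) * (nuCount d V t.1 : ℝ≥0∞)) < ⊤ →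
        (ENNReal.ofReal c₀ *
            Filter.limsup (fun s : ℝ =>
              ENNReal.ofReal (s ^ q) * (nuCount d V s : ℝ≥0∞)) (𝓝[>] (0 : ℝ)) ≤
          Filter.limsup (fun s : ℝ =>
            ENNReal.ofReal (s ^ q) * (nCount d V s : ℝ≥0∞)) (𝓝[>] (0 : ℝ))) ∧
        (Filter.limsup (fun s : ℝ =>
            ENNReal.ofReal (s ^ q) * (nCount d V s : ℝ≥0∞)) (𝓝[>] (0 : ℝ)) ≤
          ENNReal.ofReal c₁ *
            Filter.limsup (fun s : ℝ =>
              ENNReal.ofReal (s ^ q) * (nuCount d V s : ℝ≥0∞)) (𝓝[>] (0 : ℝ))) ∧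
        (Filter.Tendsto (fun s : ℝ =>
            ENNReal.ofReal (s ^ q) * (nCount d V s : ℝ≥0∞)) (𝓝[>] (0 : ℝ)) (𝓝 0) ↔
          Filter.Tendsto (fun s : ℝ =>
            ENNReal.ofReal (s ^ q) * (nuCount d V s : ℝ≥0∞)) (𝓝[>] (0 : ℝ)) (𝓝 0)) := by
  have hd0 : 0 < d := by omega
  have hκ : (0 : ℝ) < (4 * d : ℝ)⁻¹ ^ q := by positivity
  have hC := upperConst_ne_top hd hq'
  have hC0 : upperConst d q ≠ 0 := (zero_lt_one.trans_le le_self_add).ne'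
  refine ⟨(4 * d : ℝ)⁻¹ ^ q, (upperConst d q).toReal, hκ, ENNReal.toReal_pos hC0 hC,
    fun V _ _ => ?_⟩
  have hlower := ofReal_mul_limsup_nuCount_le hd0 q V
  have hupper := limsup_nCount_le hd hq' V
  rw [ENNReal.ofReal_toReal hC]
  refine ⟨hlower, hupper, ?_⟩
  rw [tendsto_zero_iff_limsup_eq_zero, tendsto_zero_iff_limsup_eq_zero]
  constructor
  · intro h
    rw [h, nonpos_iff_eq_zero, mul_eq_zero] at hlower
    exact hlower.resolve_left (ENNReal.ofReal_pos.2 hκ).ne'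
  · intro h
    rwa [h, mul_zero, nonpos_iff_eq_zero] at hupper
end
end

section
/- Let d ≥ 1. There exists a constant C = C(d) such that for every weight W : ℤ^d → [0,∞) and every function u : ℤ^d → ℂ one has, in [0,∞], Σ_{x∈ℤ^d} W(x)|u(x)|² ≤ C · ∫_{ℝ^d} (𝒥W)(ξ) · |(𝓘u)(ξ)|² dξ. -/
open scoped ENNReal NNReal Topology
open Filter MeasureTheory

noncomputable section

/-- The poly-linear interpolation polynomial on the cell with lower-left vertex `x`,
evaluated at local coordinates `t ∈ [0,1]^d`. -/
def interpCell {d : ℕ} (u : (Fin d → ℤ) → ℂ) (x : Fin d → ℤ) (t : Fin d → ℝ) : ℂ :=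
  ∑ ε : Fin d → Fin 2, u (x + fun i => ((ε i : ℕ) : ℤ)) *
    ((∏ j, ((1 - ((ε j : ℕ) : ℝ)) * (1 - t j) + ((ε j : ℕ) : ℝ) * t j) : ℝ) : ℂ)

/-- The poly-linear interpolation `𝓘u : ℝ^d → ℂ` of `u : ℤ^d → ℂ`. -/
def interp {d : ℕ} (u : (Fin d → ℤ) → ℂ) (ξ : Fin d → ℝ) : ℂ :=
  interpCell u (fun i => ⌊ξ i⌋) (fun i => ξ i - ⌊ξ i⌋)

/-- The unit cell of `ℝ^d` with lower-left vertex `x`. -/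
def latticeCell {d : ℕ} (x : Fin d → ℤ) : Set (Fin d → ℝ) :=
  Set.univ.pi fun i => Set.Ico (x i : ℝ) (x i + 1)

theorem mem_latticeCell {d : ℕ} {x : Fin d → ℤ} {ξ : Fin d → ℝ} :
    ξ ∈ latticeCell x ↔ (fun i => ⌊ξ i⌋) = x := by
  simp [latticeCell, funext_iff, Int.floor_eq_iff]

theorem measurableSet_latticeCell {d : ℕ} (x : Fin d → ℤ) : MeasurableSet (latticeCell x) :=
  MeasurableSet.univ_pi fun _ => measurableSet_Ico

theorem volume_latticeCell {d : ℕ} (x : Fin d → ℤ) : volume (latticeCell x) = 1 := by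
  simp [latticeCell, volume_pi_pi]

theorem lintegral_eq_tsum_latticeCell {d : ℕ} (f : (Fin d → ℝ) → ℝ≥0∞) :
    ∫⁻ ξ, f ξ = ∑' x : Fin d → ℤ, ∫⁻ ξ in latticeCell x, f ξ := by
  have hU : ⋃ x : Fin d → ℤ, latticeCell x = Set.univ :=
    Set.eq_univ_of_forall fun ξ => Set.mem_iUnion.2 ⟨fun i => ⌊ξ i⌋, mem_latticeCell.2 rfl⟩
  rw [← setLIntegral_univ, ← hU, lintegral_iUnion measurableSet_latticeCell]
  intro x y hxy
  refine Set.disjoint_left.2 fun ξ hx hy => hxy ?_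
  rw [← mem_latticeCell.1 hx, mem_latticeCell.1 hy]

/-- The polynomial `4 - 6t` is dual to the nodal function at `0` among the affine nodal functions
on a unit interval. -/
theorem integral_nodal_mul_dual (a : ℝ) (e : Fin 2) :
    ∫ t in Set.Ico a (a + 1),
      ((1 - ((e : ℕ) : ℝ)) * (1 - (t - a)) + ((e : ℕ) : ℝ) * (t - a)) * (4 - 6 * (t - a)) =
      if e = 0 then 1 else 0 := by
  rw [integral_Ico_eq_integral_Ioc, ← intervalIntegral.integral_of_le (by linarith),
    intervalIntegral.integral_comp_sub_right
      (fun s => ((1 - ((e : ℕ) : ℝ)) * (1 - s) + ((e : ℕ) : ℝ) * s) * (4 - 6 * s)) a]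
  have hd : ∀ s ∈ Set.uIcc (a - a) (a + 1 - a), HasDerivAt
      (fun s : ℝ => (1 - ((e : ℕ) : ℝ)) * (4 * s - 5 * s ^ 2 + 2 * s ^ 3) +
        ((e : ℕ) : ℝ) * (2 * s ^ 2 - 2 * s ^ 3))
      (((1 - ((e : ℕ) : ℝ)) * (1 - s) + ((e : ℕ) : ℝ) * s) * (4 - 6 * s)) s := by
    intro s _
    have h1 := hasDerivAt_id' s
    have h2 := hasDerivAt_pow 2 s
    have h3 := hasDerivAt_pow 3 s
    refine HasDerivAt.congr_deriv (((((h1.const_mul 4).sub (h2.const_mul 5)).add (h3.const_mul 2)).const_mul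
      (1 - ((e : ℕ) : ℝ))).add (((h2.const_mul 2).sub (h3.const_mul 2)).const_mul
      ((e : ℕ) : ℝ))) ?_
    push_cast
    ring
  rw [intervalIntegral.integral_eq_sub_of_hasDerivAt hd
    (Continuous.intervalIntegrable (by fun_prop) _ _)]
  fin_cases e <;> norm_num

theorem continuous_interpCell {d : ℕ} (u : (Fin d → ℤ) → ℂ) (x : Fin d → ℤ) :
    Continuous fun ξ : Fin d → ℝ => interpCell u x fun i => ξ i - x i := by
  unfold interpCell
  fun_prop

theorem integral_interpCell_mul_dual {d : ℕ} (u : (Fin d → ℤ) → ℂ) (x : Fin d → ℤ) :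
    ∫ ξ in latticeCell x,
      interpCell u x (fun i => ξ i - x i) * ((∏ j, (4 - 6 * (ξ j - x j)) : ℝ) : ℂ) = u x := by
  have hint : ∀ f : (Fin d → ℝ) → ℂ, Continuous f → IntegrableOn f (latticeCell x) := by
    intro f hf
    refine (hf.continuousOn.integrableOn_compact
      (isCompact_univ_pi fun i => isCompact_Icc)).mono_set
      (Set.pi_mono fun i _ => Set.Ico_subset_Icc_self)
  have hprod (ε : Fin d → Fin 2) : ∫ ξ in latticeCell x,
      ∏ j, (((1 - ((ε j : ℕ) : ℝ)) * (1 - (ξ j - x j)) + ((ε j : ℕ) : ℝ) * (ξ j - x j)) *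
        (4 - 6 * (ξ j - x j))) = if ε = 0 then 1 else 0 := by
    rw [latticeCell, volume_pi, Measure.restrict_pi_pi,
      integral_fintype_prod_eq_prod (𝕜 := ℝ) (fun j (t : ℝ) =>
        ((1 - ((ε j : ℕ) : ℝ)) * (1 - (t - x j)) + ((ε j : ℕ) : ℝ) * (t - x j)) *
        (4 - 6 * (t - x j)))]
    simp_rw [integral_nodal_mul_dual]
    simp [Finset.prod_ite_zero, funext_iff]
  have hterm (ε : Fin d → Fin 2) : ∫ ξ in latticeCell x,
      u (x + fun i => ((ε i : ℕ) : ℤ)) *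
        ((∏ j, ((1 - ((ε j : ℕ) : ℝ)) * (1 - (ξ j - x j)) +
          ((ε j : ℕ) : ℝ) * (ξ j - x j)) : ℝ) : ℂ) *
        ((∏ j, (4 - 6 * (ξ j - x j)) : ℝ) : ℂ) = if ε = 0 then u x else 0 := by
    simp_rw [mul_assoc, ← Complex.ofReal_mul, ← Finset.prod_mul_distrib]
    rw [integral_const_mul, integral_complex_ofReal, hprod]
    split_ifs with h
    · subst h
      simp only [Pi.zero_apply, Fin.val_zero, Nat.cast_zero, Complex.ofReal_one, mul_one]
      exact congrArg u (add_zero x)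
    · simp
  simp_rw [interpCell, Finset.sum_mul]
  rw [integral_finsetSum _ fun ε _ => hint _ (by fun_prop)]
  simp_rw [hterm]
  simp

theorem lintegral_sq_le {α : Type*} [MeasurableSpace α] (μ : Measure α) [IsProbabilityMeasure μ]
    {f : α → ℝ≥0∞} (hf : AEMeasurable f μ) : (∫⁻ a, f a ∂μ) ^ 2 ≤ ∫⁻ a, f a ^ 2 ∂μ := by
  have h := ENNReal.lintegral_mul_le_Lp_mul_Lq μ Real.HolderConjugate.two_two hf
    (aemeasurable_const (b := (1 : ℝ≥0∞)))
  simp only [Pi.mul_apply, mul_one, ENNReal.one_rpow, lintegral_const, measure_univ] at h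
  calc (∫⁻ a, f a ∂μ) ^ 2 ≤ ((∫⁻ a, f a ^ (2 : ℝ) ∂μ) ^ (1 / 2 : ℝ)) ^ 2 := by gcongr
    _ = ∫⁻ a, f a ^ 2 ∂μ := by
      rw [← ENNReal.rpow_natCast, ← ENNReal.rpow_mul]
      norm_num

theorem enorm_sq_le_lintegral_interpCell {d : ℕ} (u : (Fin d → ℤ) → ℂ) (x : Fin d → ℤ) :
    ((‖u x‖₊ : ℝ≥0∞)) ^ 2 ≤ 16 ^ d * ∫⁻ ξ in latticeCell x,
      ((‖interpCell u x (fun i => ξ i - x i)‖₊ : ℝ≥0∞)) ^ 2 := by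
  have : IsProbabilityMeasure (volume.restrict (latticeCell x)) :=
    ⟨by rw [Measure.restrict_apply_univ, volume_latticeCell]⟩
  have hdual {ξ : Fin d → ℝ} (hξ : ξ ∈ latticeCell x) :
      ‖((∏ j, (4 - 6 * (ξ j - x j)) : ℝ) : ℂ)‖ₑ ≤ 4 ^ d := by
    have hr : ‖((∏ j, (4 - 6 * (ξ j - x j)) : ℝ) : ℂ)‖ ≤ 4 ^ d := by
      rw [Complex.norm_real, Real.norm_eq_abs, Finset.abs_prod]
      refine (Finset.prod_le_prod (g := fun _ => 4) (fun _ _ => abs_nonneg _)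
        fun j _ => ?_).trans_eq (by simp)
      have hj := hξ j trivial
      rw [abs_le]
      constructor <;> linarith [hj.1, hj.2]
    rw [← ofReal_norm]
    refine (ENNReal.ofReal_le_ofReal hr).trans_eq ?_
    rw [ENNReal.ofReal_pow (by norm_num), ENNReal.ofReal_ofNat]
  have hL1 : ‖u x‖ₑ ≤ 4 ^ d * ∫⁻ ξ in latticeCell x,
      ‖interpCell u x (fun i => ξ i - x i)‖ₑ := by
    rw [← lintegral_const_mul' _ _ (by finiteness)]
    nth_rewrite 1 [← integral_interpCell_mul_dual u x]
    refine (enorm_integral_le_lintegral_enorm _).trans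
      (setLIntegral_mono' (measurableSet_latticeCell x) fun ξ hξ => ?_)
    rw [enorm_mul, mul_comm]
    gcongr
    exact hdual hξ
  calc ‖u x‖ₑ ^ 2 ≤ (4 ^ d * ∫⁻ ξ in latticeCell x,
        ‖interpCell u x (fun i => ξ i - x i)‖ₑ) ^ 2 := by gcongr
    _ = 16 ^ d * (∫⁻ ξ in latticeCell x, ‖interpCell u x (fun i => ξ i - x i)‖ₑ) ^ 2 := by
      rw [mul_pow, ← pow_mul, mul_comm d, pow_mul]
      norm_num
    _ ≤ _ := by
      gcongr
      exact lintegral_sq_le _ (continuous_interpCell u x).enorm.aemeasurable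

/-- `Σ_x W(x)|u(x)|² ≤ C ∫_{ℝ^d} (𝒥W)(ξ)|(𝓘u)(ξ)|² dξ`. -/
theorem weight_interpolation_bound (d : ℕ) (hd : 1 ≤ d) :
    ∃ C : ℝ, 0 < C ∧
      ∀ W : (Fin d → ℤ) → ℝ, (∀ x, 0 ≤ W x) →
      ∀ u : (Fin d → ℤ) → ℂ,
        bV W u ≤
          ENNReal.ofReal C *
            ∫⁻ ξ : Fin d → ℝ,
              ENNReal.ofReal (W fun i => ⌊ξ i⌋) * ((‖interp u ξ‖₊ : ℝ≥0∞)) ^ 2 := by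
  refine ⟨16 ^ d, by positivity, fun W _ u => ?_⟩
  rw [bV, ENNReal.ofReal_pow (by norm_num), ENNReal.ofReal_ofNat,
    lintegral_eq_tsum_latticeCell, ← ENNReal.tsum_mul_left]
  refine ENNReal.tsum_le_tsum fun x => ?_
  have h : ∫⁻ ξ in latticeCell x,
      ENNReal.ofReal (W fun i => ⌊ξ i⌋) * ((‖interp u ξ‖₊ : ℝ≥0∞)) ^ 2 =
      ENNReal.ofReal (W x) * ∫⁻ ξ in latticeCell x,
        ((‖interpCell u x (fun i => ξ i - x i)‖₊ : ℝ≥0∞)) ^ 2 := by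
    rw [← lintegral_const_mul' _ _ ENNReal.ofReal_ne_top]
    refine setLIntegral_congr_fun (measurableSet_latticeCell x) fun ξ hξ => ?_
    have hx : (fun i => ⌊ξ i⌋) = x := mem_latticeCell.1 hξ
    have hi : ∀ i, ⌊ξ i⌋ = x i := congrFun hx
    simp only [interp, hi]
  rw [h, mul_left_comm]
  gcongr
  exact enorm_sq_le_lintegral_interpCell u x
end
end
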